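/- arXiv:hep-th/0508048 — 2 statements merged into one kernel-verified Lean document; each statement's English description precedes it below -/
import Mathlib

section
/- Noether identities: for every spin-3 field h on ℝⁿ (n ≥ 1), the Einstein tensor satisfies identically ∂^ρ G_{μνρ}(x) − (1/n) η_{μν} ∂^ρ G_ρ(x) = 0 for all x ∈ ℝⁿ and all μ, ν, where G_ρ := η^{μν}G_{μνρ} and ∂^ρ := η^{ρσ}∂_σ. -/
open MeasureTheory

noncomputable section

/-- Mostly-plus Minkowski metric `η_{μν} = diag(−1,+1,…,+1)` on `ℝⁿ`
(it coincides with its inverse `η^{μν}`). -/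
def eta (n : ℕ) (μ ν : Fin n) : ℝ :=
  if μ = ν then (if (μ : ℕ) = 0 then -1 else 1) else 0

/-- Partial derivative `∂_μ` of a scalar function on `ℝⁿ`. -/
def pd {n : ℕ} (μ : Fin n) (f : (Fin n → ℝ) → ℝ) : (Fin n → ℝ) → ℝ :=
  fun x => fderiv ℝ f x (Pi.single μ 1)

/-- A rank-3 covariant tensor field on `ℝⁿ` (the type of spin-3 fields). -/
abbrev Spin3 (n : ℕ) := (Fin n → ℝ) → Fin n → Fin n → Fin n → ℝ

/-- Trace `h_μ := η^{νρ} h_{μνρ}`. -/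
def trH {n : ℕ} (h : Spin3 n) (x : Fin n → ℝ) (μ : Fin n) : ℝ :=
  ∑ ν, ∑ ρ, eta n ν ρ * h x μ ν ρ

/-- Fronsdal tensor
`F_{μνρ} := □h_{μνρ} − ∂^σ(∂_μ h_{νρσ} + ∂_ν h_{ρμσ} + ∂_ρ h_{μνσ})
  + ∂_μ∂_ν h_ρ + ∂_ν∂_ρ h_μ + ∂_ρ∂_μ h_ν`. -/
def fronsdal {n : ℕ} (h : Spin3 n) (x : Fin n → ℝ) (μ ν ρ : Fin n) : ℝ :=
  (∑ σ, ∑ τ, eta n σ τ * pd σ (pd τ (fun y => h y μ ν ρ)) x)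
  - (∑ σ, ∑ τ, eta n σ τ *
      pd τ (fun y => pd μ (fun z => h z ν ρ σ) y + pd ν (fun z => h z ρ μ σ) y
        + pd ρ (fun z => h z μ ν σ) y) x)
  + pd μ (pd ν (fun z => trH h z ρ)) x
  + pd ν (pd ρ (fun z => trH h z μ)) x
  + pd ρ (pd μ (fun z => trH h z ν)) x

/-- Trace of the Fronsdal tensor, `F_ρ := η^{μν} F_{μνρ}`. -/
def trF {n : ℕ} (h : Spin3 n) (x : Fin n → ℝ) (ρ : Fin n) : ℝ :=
  ∑ μ, ∑ ν, eta n μ ν * fronsdal h x μ ν ρ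

/-- Einstein tensor `G_{μνρ} := F_{μνρ} − (1/2)(η_{μν}F_ρ + η_{νρ}F_μ + η_{ρμ}F_ν)`. -/
def einstein {n : ℕ} (h : Spin3 n) (x : Fin n → ℝ) (μ ν ρ : Fin n) : ℝ :=
  fronsdal h x μ ν ρ
    - (1/2) * (eta n μ ν * trF h x ρ + eta n ν ρ * trF h x μ + eta n ρ μ * trF h x ν)

/-- Gauge transformation `(δ_λ h)_{μνρ} := ∂_μ λ_{νρ} + ∂_ν λ_{ρμ} + ∂_ρ λ_{μν}`. -/
def gaugeTransform {n : ℕ} (lam : (Fin n → ℝ) → Fin n → Fin n → ℝ) : Spin3 n :=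
  fun x μ ν ρ => pd μ (fun y => lam y ν ρ) x + pd ν (fun y => lam y ρ μ) x
    + pd ρ (fun y => lam y μ ν) x

/-- Curvature tensor `K_{αμ|βν|γρ}`: the antisymmetrization of `∂_α∂_β∂_γ h_{μνρ}`
in each of the index pairs `(α,μ)`, `(β,ν)`, `(γ,ρ)`. -/
def curvature {n : ℕ} (h : Spin3 n) (x : Fin n → ℝ) (α μ β ν γ ρ : Fin n) : ℝ :=
  pd α (pd β (pd γ (fun y => h y μ ν ρ))) x
  - pd μ (pd β (pd γ (fun y => h y α ν ρ))) x
  - pd α (pd ν (pd γ (fun y => h y μ β ρ))) x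
  - pd α (pd β (pd ρ (fun y => h y μ ν γ))) x
  + pd μ (pd ν (pd γ (fun y => h y α β ρ))) x
  + pd μ (pd β (pd ρ (fun y => h y α ν γ))) x
  + pd α (pd ν (pd ρ (fun y => h y μ β γ))) x
  - pd μ (pd ν (pd ρ (fun y => h y α β γ))) x

/-- The free Fronsdal Lagrangian density for a single spin-3 field (all
contractions performed with the Minkowski metric `η`). -/
def lag {n : ℕ} (h : Spin3 n) (x : Fin n → ℝ) : ℝ :=
  -(1/2) * (∑ σ, ∑ τ, ∑ μ, ∑ μ', ∑ ν, ∑ ν', ∑ ρ, ∑ ρ',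
      eta n σ τ * eta n μ μ' * eta n ν ν' * eta n ρ ρ' *
        pd σ (fun y => h y μ ν ρ) x * pd τ (fun y => h y μ' ν' ρ') x)
  + (3/2) * (∑ μ, ∑ μ', ∑ ν, ∑ ν', ∑ ρ, ∑ ρ', ∑ σ, ∑ σ',
      eta n μ μ' * eta n ν ν' * eta n ρ ρ' * eta n σ σ' *
        pd μ' (fun y => h y μ ρ σ) x * pd ν (fun y => h y ν' ρ' σ') x)
  + (3/2) * (∑ μ, ∑ μ', ∑ ν, ∑ ν',
      eta n μ μ' * eta n ν ν' * pd μ (fun y => trH h y ν) x * pd μ' (fun y => trH h y ν') x)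
  + (3/4) * (∑ μ, ∑ μ', ∑ ν, ∑ ν',
      eta n μ μ' * eta n ν ν' * pd μ (fun y => trH h y μ') x * pd ν (fun y => trH h y ν') x)
  - 3 * (∑ μ, ∑ μ', ∑ ν, ∑ ν', ∑ ρ, ∑ ρ',
      eta n μ μ' * eta n ν ν' * eta n ρ ρ' *
        pd μ (fun y => trH h y ν) x * pd ρ (fun y => h y ρ' μ' ν') x)

/-- The free spin-3 (Fronsdal) action for a single field. -/
def action {n : ℕ} (h : Spin3 n) : ℝ := ∫ x : Fin n → ℝ, lag h x

open scoped ContDiff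

/-- The sign `η_{μμ}` of the `μ`-th diagonal entry of the Minkowski metric. -/
def etaSign (n : ℕ) (μ : Fin n) : ℝ := if (μ : ℕ) = 0 then -1 else 1

lemma etaSign_mul_self (n : ℕ) (μ : Fin n) : etaSign n μ * etaSign n μ = 1 := by
  unfold etaSign; split_ifs <;> norm_num

lemma eta_eq_ite (n : ℕ) (μ ν : Fin n) : eta n μ ν = if μ = ν then etaSign n μ else 0 := rfl

/-- Contraction with `η` only involves the diagonal entries. -/
lemma sum_eta_mul {n : ℕ} (f : Fin n → Fin n → ℝ) :
    ∑ μ, ∑ ν, eta n μ ν * f μ ν = ∑ μ, etaSign n μ * f μ μ := by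
  simp [eta_eq_ite, ite_mul]

/-- The real vector space of smooth scalar functions on `ℝⁿ`. -/
def smoothFun (n : ℕ) : Submodule ℝ ((Fin n → ℝ) → ℝ) where
  carrier := {f | ContDiff ℝ ∞ f}
  add_mem' {f g} (hf : ContDiff ℝ ∞ f) (hg : ContDiff ℝ ∞ g) := hf.add hg
  zero_mem' := (contDiff_const : ContDiff ℝ ∞ fun _ : Fin n → ℝ => (0 : ℝ))
  smul_mem' c f (hf : ContDiff ℝ ∞ f) := hf.const_smul c

lemma contDiff_smoothFun {n : ℕ} (f : smoothFun n) : ContDiff ℝ ∞ (f : (Fin n → ℝ) → ℝ) := f.2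

lemma differentiableAt_smoothFun {n : ℕ} (f : smoothFun n) (x : Fin n → ℝ) :
    DifferentiableAt ℝ (f : (Fin n → ℝ) → ℝ) x :=
  (contDiff_smoothFun f).differentiable (by simp) x

/-- The partial derivative `∂_μ` as an endomorphism of the space of smooth functions. -/
def pdLin {n : ℕ} (μ : Fin n) : smoothFun n →ₗ[ℝ] smoothFun n where
  toFun f := ⟨pd μ f, ((contDiff_smoothFun f).fderiv_right (m := ∞) (by simp)).clm_apply contDiff_const⟩
  map_add' f g := by
    ext x
    simp [pd, fderiv_add (differentiableAt_smoothFun f x) (differentiableAt_smoothFun g x)]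
  map_smul' c f := by
    ext x
    simp [pd, fderiv_const_smul (differentiableAt_smoothFun f x)]

lemma coe_pdLin {n : ℕ} (μ : Fin n) (f : smoothFun n) :
    (pdLin μ f : (Fin n → ℝ) → ℝ) = pd μ f := rfl

lemma pdLin_comm {n : ℕ} (μ ν : Fin n) (f : smoothFun n) :
    pdLin μ (pdLin ν f) = pdLin ν (pdLin μ f) := by
  have hd : Differentiable ℝ (fderiv ℝ (f : (Fin n → ℝ) → ℝ)) :=
    ((contDiff_smoothFun f).fderiv_right (m := ∞) (by simp)).differentiable (by simp)
  have key : ∀ (α β : Fin n) (x : Fin n → ℝ), pd α (pd β (f : (Fin n → ℝ) → ℝ)) x =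
      fderiv ℝ (fderiv ℝ (f : (Fin n → ℝ) → ℝ)) x (Pi.single α 1) (Pi.single β 1) := by
    intro α β x
    change fderiv ℝ (fun y => fderiv ℝ (f : (Fin n → ℝ) → ℝ) y (Pi.single β 1)) x _ = _
    rw [fderiv_clm_apply (hd x) (differentiableAt_const _)]
    simp
  ext x
  rw [coe_pdLin, coe_pdLin, coe_pdLin, coe_pdLin, key, key]
  exact (contDiff_smoothFun f).contDiffAt.isSymmSndFDerivAt
    (by simpa using WithTop.coe_le_coe.2 (le_top : (2 : ℕ∞) ≤ ⊤)) _ _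

section Bianchi

variable {n : ℕ} {V : Type*} [AddCommGroup V] [Module ℝ V]

/-- The Bianchi identity `∂^ρ F_{μνρ} = (1/2)(∂_μ F_ν + ∂_ν F_μ)` for the Fronsdal tensor,
for commuting operators `D μ` and an arbitrary diagonal metric `e`. -/
lemma fronsdal_bianchi (e : Fin n → ℝ) (D : Fin n → V →ₗ[ℝ] V)
    (hD : ∀ μ ν v, D μ (D ν v) = D ν (D μ v))
    (H F : Fin n → Fin n → Fin n → V) (T F' : Fin n → V)
    (h₁ : ∀ μ ν ρ, H μ ν ρ = H ν μ ρ) (h₂ : ∀ μ ν ρ, H μ ν ρ = H μ ρ ν)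
    (hT : ∀ μ, T μ = ∑ ν, e ν • H μ ν ν)
    (hF : ∀ μ ν ρ, F μ ν ρ = (∑ σ, e σ • D σ (D σ (H μ ν ρ)))
      - (∑ σ, e σ • D σ (D μ (H ν ρ σ) + D ν (H ρ μ σ) + D ρ (H μ ν σ)))
      + D μ (D ν (T ρ)) + D ν (D ρ (T μ)) + D ρ (D μ (T ν)))
    (hF' : ∀ ρ, F' ρ = ∑ μ, e μ • F μ μ ρ) (μ ν : Fin n) :
    ∑ ρ, e ρ • D ρ (F μ ν ρ) = (1 / 2 : ℝ) • (D μ (F' ν) + D ν (F' μ)) := by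
  obtain ⟨B, hB⟩ : ∃ B : V →ₗ[ℝ] V, ∀ v, B v = ∑ σ, e σ • D σ (D σ v) :=
    ⟨∑ σ, e σ • (D σ ∘ₗ D σ), fun v => by simp⟩
  have hBD : ∀ α v, D α (B v) = B (D α v) := by
    intro α v
    simp only [hB, map_sum, map_smul]
    refine Finset.sum_congr rfl fun σ _ => ?_
    rw [hD α σ, hD α σ]
  obtain ⟨dH, hdH⟩ : ∃ dH : Fin n → Fin n → V, ∀ α β, dH α β = ∑ σ, e σ • D σ (H α β σ) :=
    ⟨_, fun _ _ => rfl⟩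
  obtain ⟨ddH, hddH⟩ : ∃ ddH : Fin n → V, ∀ α, ddH α = ∑ σ, e σ • D σ (dH α σ) :=
    ⟨_, fun _ => rfl⟩
  obtain ⟨dT, hdT⟩ : ∃ dT : V, dT = ∑ σ, e σ • D σ (T σ) := ⟨_, rfl⟩
  have hdHsym : ∀ α β, dH α β = dH β α := fun α β => by
    simp only [hdH, h₁ α β]
  have hpull : ∀ α (f : Fin n → V), ∑ σ, e σ • D σ (D α (f σ)) = D α (∑ σ, e σ • D σ (f σ)) := by
    intro α f
    simp only [map_sum, map_smul, hD α]
  have hpull₂ : ∀ α (f : Fin n → V),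
      ∑ σ, e σ • D α (D σ (f σ)) = D α (∑ σ, e σ • D σ (f σ)) := by
    intro α f
    simp only [map_sum, map_smul]
  have hFs : ∀ μ ν ρ, F μ ν ρ = B (H μ ν ρ) - (D μ (dH ν ρ) + D ν (dH ρ μ) + D ρ (dH μ ν))
      + D μ (D ν (T ρ)) + D ν (D ρ (T μ)) + D ρ (D μ (T ν)) := by
    intro μ ν ρ
    simp only [hF, map_add, smul_add, Finset.sum_add_distrib, hpull, ← hB, ← hdH]
  have hBT : ∀ ρ, ∑ α, e α • B (H α α ρ) = B (T ρ) := by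
    intro ρ
    simp only [hT, map_sum, map_smul]
    exact Finset.sum_congr rfl fun α _ => by rw [h₂ α α ρ, h₁ α ρ α]
  have htrd : ∑ α, e α • dH α α = dT := by
    simp only [hdH, hdT, hT, map_sum, map_smul, Finset.smul_sum]
    rw [Finset.sum_comm]
    refine Finset.sum_congr rfl fun σ _ => Finset.sum_congr rfl fun α _ => ?_
    rw [smul_comm, h₂ α α σ, h₁ α σ α]
  have hBdH : ∑ ρ, e ρ • D ρ (B (H μ ν ρ)) = B (dH μ ν) := by
    simp only [hBD, hdH, map_sum, map_smul]
  have hF's : ∀ ρ, F' ρ = (2 : ℝ) • B (T ρ) - (2 : ℝ) • D ρ dT - (2 : ℝ) • ddH ρ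
      + D ρ dT + (2 : ℝ) • D ρ dT := by
    intro ρ
    have e1 : ∑ α, e α • D α (dH α ρ) = ddH ρ := by simp only [hddH, hdHsym ρ]
    have e2 : ∑ α, e α • D α (dH ρ α) = ddH ρ := (hddH ρ).symm
    have e3 : ∑ α, e α • D ρ (dH α α) = D ρ dT := by
      rw [← htrd]; simp only [map_sum, map_smul]
    have e4 : ∑ α, e α • D α (D α (T ρ)) = B (T ρ) := (hB _).symm
    have e5 : ∑ α, e α • D α (D ρ (T α)) = D ρ dT := by rw [hpull, hdT]
    have e6 : ∑ α, e α • D ρ (D α (T α)) = D ρ dT := by rw [hpull₂, hdT]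
    simp only [hF', hFs, smul_add, smul_sub, Finset.sum_add_distrib, Finset.sum_sub_distrib,
      hBT, e1, e2, e3, e4, e5, e6]
    module
  have d1 : ∑ ρ, e ρ • D ρ (D μ (dH ν ρ)) = D μ (ddH ν) := by rw [hpull, hddH]
  have d2 : ∑ ρ, e ρ • D ρ (D ν (dH ρ μ)) = D ν (ddH μ) := by
    rw [hpull, hddH]; simp only [hdHsym μ]
  have d3 : ∑ ρ, e ρ • D ρ (D ρ (dH μ ν)) = B (dH μ ν) := (hB _).symm
  have d4 : ∑ ρ, e ρ • D ρ (D μ (D ν (T ρ))) = D μ (D ν dT) := by rw [hpull, hpull, hdT]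
  have d5 : ∑ ρ, e ρ • D ρ (D ν (D ρ (T μ))) = B (D ν (T μ)) := by
    rw [hpull, ← hB, hBD]
  have d6 : ∑ ρ, e ρ • D ρ (D ρ (D μ (T ν))) = B (D μ (T ν)) := (hB _).symm
  simp only [hFs, map_add, map_sub, smul_add, smul_sub, Finset.sum_add_distrib,
    Finset.sum_sub_distrib, hBdH, d1, d2, d3, d4, d5, d6]
  simp only [hF's, map_add, map_sub, map_smul, hBD, hD ν μ]
  module

end Bianchi

/-- **Noether identities.**  For every spin-3 field `h` on `ℝⁿ` (`n ≥ 1`), the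
Einstein tensor satisfies identically
`∂^ρ G_{μνρ} − (1/n) η_{μν} ∂^ρ G_ρ = 0`, where `G_ρ := η^{μν} G_{μνρ}`. -/
theorem noether_identities (n : ℕ) (hn : 1 ≤ n) (h : Spin3 n)
    (hsmooth : ∀ μ ν ρ : Fin n, ContDiff ℝ (⊤ : ℕ∞) fun x => h x μ ν ρ)
    (hsym₁ : ∀ x μ ν ρ, h x μ ν ρ = h x ν μ ρ)
    (hsym₂ : ∀ x μ ν ρ, h x μ ν ρ = h x μ ρ ν) :
    ∀ (x : Fin n → ℝ) (μ ν : Fin n),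
      (∑ ρ, ∑ σ, eta n ρ σ * pd σ (fun y => einstein h y μ ν ρ) x)
        - (1 / (n : ℝ)) * eta n μ ν *
            (∑ ρ, ∑ σ, eta n ρ σ *
              pd σ (fun y => ∑ α, ∑ β, eta n α β * einstein h y α β ρ) x) = 0 := by
  intro x μ ν
  let e := etaSign n
  let H : Fin n → Fin n → Fin n → smoothFun n := fun μ ν ρ => ⟨fun x => h x μ ν ρ, hsmooth μ ν ρ⟩
  let T : Fin n → smoothFun n := fun μ => ∑ ν, e ν • H μ ν ν
  let F : Fin n → Fin n → Fin n → smoothFun n := fun μ ν ρ =>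
    (∑ σ, e σ • pdLin σ (pdLin σ (H μ ν ρ)))
      - (∑ σ, e σ • pdLin σ (pdLin μ (H ν ρ σ) + pdLin ν (H ρ μ σ) + pdLin ρ (H μ ν σ)))
      + pdLin μ (pdLin ν (T ρ)) + pdLin ν (pdLin ρ (T μ)) + pdLin ρ (pdLin μ (T ν))
  let F' : Fin n → smoothFun n := fun ρ => ∑ μ, e μ • F μ μ ρ
  let G : Fin n → Fin n → Fin n → smoothFun n := fun μ ν ρ =>
    F μ ν ρ - (1 / 2 : ℝ) • (eta n μ ν • F' ρ + eta n ν ρ • F' μ + eta n ρ μ • F' ν)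
  have coeT : ∀ ρ, (fun z => trH h z ρ) = (T ρ : (Fin n → ℝ) → ℝ) := by
    intro ρ; funext z
    simp [T, H, e, trH, sum_eta_mul]
  have coeF : ∀ y μ ν ρ, fronsdal h y μ ν ρ = (F μ ν ρ : (Fin n → ℝ) → ℝ) y := by
    intro y μ ν ρ
    simp only [fronsdal, sum_eta_mul, coeT, F, Submodule.coe_add, Submodule.coe_sub,
      Submodule.coe_sum, Submodule.coe_smul, Pi.add_apply, Pi.sub_apply, Finset.sum_apply,
      Pi.smul_apply, smul_eq_mul, coe_pdLin]
    rfl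
  have coeF' : ∀ y ρ, trF h y ρ = (F' ρ : (Fin n → ℝ) → ℝ) y := by
    intro y ρ
    simp [trF, sum_eta_mul, coeF, F', e]
  have coeG : ∀ μ ν ρ, (fun y => einstein h y μ ν ρ) = (G μ ν ρ : (Fin n → ℝ) → ℝ) := by
    intro μ ν ρ; funext y
    simp [einstein, coeF, coeF', G]
    ring
  have bianchi := fronsdal_bianchi e pdLin pdLin_comm H F T F'
    (fun μ ν ρ => Subtype.ext (funext fun x => hsym₁ x μ ν ρ))
    (fun μ ν ρ => Subtype.ext (funext fun x => hsym₂ x μ ν ρ))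
    (fun _ => rfl) (fun _ _ _ => rfl) (fun _ => rfl) μ ν
  have hn' : (n : ℝ) ≠ 0 := by positivity
  have sum_e_eta : ∀ (f : Fin n → smoothFun n) (α : Fin n),
      ∑ ρ, e ρ • eta n α ρ • f ρ = f α := by
    intro f α
    simp [eta_eq_ite, ite_smul, e, smul_smul, etaSign_mul_self]
  have sum_e_eta' : ∀ (f : Fin n → smoothFun n) (α : Fin n),
      ∑ ρ, e ρ • eta n ρ α • f ρ = f α := by
    intro f α
    simp [eta_eq_ite, ite_smul, e, smul_smul, etaSign_mul_self]
  have trG : ∀ ρ, ∑ α, e α • G α α ρ = (-(n : ℝ) / 2) • F' ρ := by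
    intro ρ
    have h1 : ∑ α, e α • eta n α α • F' ρ = (n : ℝ) • F' ρ := by
      simp [eta_eq_ite, e, smul_smul, etaSign_mul_self, Nat.cast_smul_eq_nsmul]
    simp only [G, smul_sub, smul_add, smul_comm (e _) (1 / 2 : ℝ), Finset.sum_sub_distrib,
      Finset.sum_add_distrib, ← Finset.smul_sum, h1, sum_e_eta', sum_e_eta]
    change F' ρ - _ = _
    module
  have coeTrG : ∀ ρ, (fun y => ∑ α, ∑ β, eta n α β * einstein h y α β ρ) =
      (((-(n : ℝ) / 2) • F' ρ : smoothFun n) : (Fin n → ℝ) → ℝ) := by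
    intro ρ; funext y
    rw [← trG, sum_eta_mul]
    simp [← coeG, e]
  have divG : ∑ ρ, e ρ • pdLin ρ (G μ ν ρ) =
      (-(1 / 2 : ℝ) * eta n μ ν) • ∑ ρ, e ρ • pdLin ρ (F' ρ) := by
    simp only [G, map_sub, map_add, map_smul, smul_sub, smul_add, smul_comm (e _) (1 / 2 : ℝ),
      Finset.sum_sub_distrib, Finset.sum_add_distrib, ← Finset.smul_sum, bianchi,
      sum_e_eta (fun ρ => pdLin ρ (F' μ)), sum_e_eta' (fun ρ => pdLin ρ (F' ν)),
      smul_comm (e _) (eta n μ ν)]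
    module
  have total : ∑ ρ, e ρ • pdLin ρ (G μ ν ρ) - (1 / (n : ℝ) * eta n μ ν) •
      ∑ ρ, e ρ • pdLin ρ ((-(n : ℝ) / 2) • F' ρ) = 0 := by
    have pull : ∑ ρ, e ρ • pdLin ρ ((-(n : ℝ) / 2) • F' ρ) =
        (-(n : ℝ) / 2) • ∑ ρ, e ρ • pdLin ρ (F' ρ) := by
      rw [Finset.smul_sum]
      exact Finset.sum_congr rfl fun ρ _ => by rw [map_smul, smul_comm]
    have coeff : 1 / (n : ℝ) * eta n μ ν * (-(n : ℝ) / 2) = -(1 / 2 : ℝ) * eta n μ ν := by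
      field_simp
    rw [divG, pull, smul_smul, coeff, sub_self]
  have := congrFun (congrArg Subtype.val total) x
  simp only [sum_eta_mul (fun ρ σ => pd σ _ x), coeG, coeTrG]
  simpa only [Submodule.coe_sub, Submodule.coe_sum, Submodule.coe_smul, Submodule.coe_zero,
    Pi.sub_apply, Finset.sum_apply, Pi.smul_apply, Pi.zero_apply, smul_eq_mul, coe_pdLin] using this
end
end

section
/- The curvature tensor is gauge invariant with unconstrained gauge parameters: for every smooth map λ : ℝⁿ → ℝ^{n²} with λ_{μν} symmetric (but not necessarily traceless), the curvature tensor of the pure gauge field h_{μνρ} := ∂_μ λ_{νρ} + ∂_ν λ_{ρμ} + ∂_ρ λ_{μν} vanishes identically: K_{αμ|βν|γρ}(x) = 0 for all x ∈ ℝⁿ and all indices. Consequently K[h + δ_λ h] = K[h] for every spin-3 field h and every such λ. -/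
open MeasureTheory

noncomputable section

lemma ContDiff.pd {n : ℕ} (μ : Fin n) {f : (Fin n → ℝ) → ℝ} (hf : ContDiff ℝ (⊤ : ℕ∞) f) :
    ContDiff ℝ (⊤ : ℕ∞) (pd μ f) :=
  (hf.fderiv_right (m := (⊤ : ℕ∞)) (by simp)).clm_apply contDiff_const

lemma pd_add {n : ℕ} (μ : Fin n) {f g : (Fin n → ℝ) → ℝ}
    (hf : ContDiff ℝ (⊤ : ℕ∞) f) (hg : ContDiff ℝ (⊤ : ℕ∞) g) :
    pd μ (f + g) = pd μ f + pd μ g := by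
  funext x
  simp [pd, fderiv_add (hf.differentiable (by simp) x) (hg.differentiable (by simp) x)]

lemma pd_comm {n : ℕ} (μ ν : Fin n) {f : (Fin n → ℝ) → ℝ} (hf : ContDiff ℝ (⊤ : ℕ∞) f) :
    pd μ (pd ν f) = pd ν (pd μ f) := by
  funext x
  have hd : DifferentiableAt ℝ (fderiv ℝ f) x :=
    (hf.fderiv_right (m := (⊤ : ℕ∞)) (by simp)).differentiable (by simp) x
  have hsymm : IsSymmSndFDerivAt ℝ f x :=
    hf.contDiffAt.isSymmSndFDerivAt (by
      rw [minSmoothness_of_isRCLikeNormedField]; exact WithTop.coe_le_coe.mpr le_top)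
  have hpd : ∀ i j : Fin n, pd i (pd j f) x
      = fderiv ℝ (fderiv ℝ f) x (Pi.single i 1) (Pi.single j 1) := fun i j => by
    have happly : HasFDerivAt (pd j f) _ x := hd.hasFDerivAt.clm_apply (hasFDerivAt_const _ x)
    rw [pd, happly.fderiv]
    simp
  rw [hpd, hpd, hsymm.eq]

lemma gaugeTransform_apply_eq {n : ℕ} (lam : (Fin n → ℝ) → Fin n → Fin n → ℝ) (μ ν ρ : Fin n) :
    (fun y => gaugeTransform lam y μ ν ρ) = pd μ (fun y => lam y ν ρ)
      + pd ν (fun y => lam y ρ μ) + pd ρ (fun y => lam y μ ν) :=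
  rfl

lemma contDiff_gaugeTransform {n : ℕ} {lam : (Fin n → ℝ) → Fin n → Fin n → ℝ}
    (hlam : ∀ μ ν : Fin n, ContDiff ℝ (⊤ : ℕ∞) fun x => lam x μ ν) (μ ν ρ : Fin n) :
    ContDiff ℝ (⊤ : ℕ∞) fun x => gaugeTransform lam x μ ν ρ :=
  (((hlam ν ρ).pd μ).add ((hlam ρ μ).pd ν)).add ((hlam μ ν).pd ρ)

lemma pd_pd_pd_add {n : ℕ} (α β γ : Fin n) {f g : (Fin n → ℝ) → ℝ}
    (hf : ContDiff ℝ (⊤ : ℕ∞) f) (hg : ContDiff ℝ (⊤ : ℕ∞) g) :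
    pd α (pd β (pd γ (f + g))) = pd α (pd β (pd γ f)) + pd α (pd β (pd γ g)) := by
  rw [pd_add γ hf hg, pd_add β (hf.pd γ) (hg.pd γ), pd_add α ((hf.pd γ).pd β) ((hg.pd γ).pd β)]

lemma curvature_add {n : ℕ} {h k : Spin3 n}
    (hh : ∀ μ ν ρ : Fin n, ContDiff ℝ (⊤ : ℕ∞) fun x => h x μ ν ρ)
    (hk : ∀ μ ν ρ : Fin n, ContDiff ℝ (⊤ : ℕ∞) fun x => k x μ ν ρ)
    (x : Fin n → ℝ) (α μ β ν γ ρ : Fin n) :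
    curvature (fun y i j l => h y i j l + k y i j l) x α μ β ν γ ρ
      = curvature h x α μ β ν γ ρ + curvature k x α μ β ν γ ρ := by
  have hadd : ∀ a b c i j l : Fin n, pd a (pd b (pd c fun y => h y i j l + k y i j l)) x
      = pd a (pd b (pd c fun y => h y i j l)) x + pd a (pd b (pd c fun y => k y i j l)) x :=
    fun a b c i j l => congrFun (pd_pd_pd_add a b c (hh i j l) (hk i j l)) x
  simp only [curvature, hadd]
  ring

lemma curvature_gaugeTransform {n : ℕ} {lam : (Fin n → ℝ) → Fin n → Fin n → ℝ}
    (hlam : ∀ μ ν : Fin n, ContDiff ℝ (⊤ : ℕ∞) fun x => lam x μ ν)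
    (hsymm : ∀ x μ ν, lam x μ ν = lam x ν μ) (x : Fin n → ℝ) (α μ β ν γ ρ : Fin n) :
    curvature (gaugeTransform lam) x α μ β ν γ ρ = 0 := by
  let D (a b c d i j : Fin n) : ℝ := pd a (pd b (pd c (pd d fun y => lam y i j))) x
  have hD : ∀ a b c i j l : Fin n, pd a (pd b (pd c fun y => gaugeTransform lam y i j l)) x
      = D a b c i j l + D a b c j i l + D a b c l i j := fun a b c i j l => by
    have hsum : ContDiff ℝ (⊤ : ℕ∞) (pd i (fun y => lam y j l) + pd j fun y => lam y l i) :=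
      ((hlam j l).pd i).add ((hlam l i).pd j)
    rw [gaugeTransform_apply_eq, pd_pd_pd_add _ _ _ hsum ((hlam i j).pd l),
      pd_pd_pd_add _ _ _ ((hlam j l).pd i) ((hlam l i).pd j),
      funext fun y => hsymm y l i]
    rfl
  have hswap₁ : ∀ a b c d i j, D a b c d i j = D b a c d i j := fun a b c d i j =>
    congrFun (pd_comm a b (((hlam i j).pd d).pd c)) x
  have hswap₂ : ∀ a b c d i j, D a b c d i j = D a c b d i j := fun a b c d i j =>
    congrFun (congrArg (pd a) (pd_comm b c ((hlam i j).pd d))) x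
  have hswap₃ : ∀ a b c d i j, D a b c d i j = D a b d c i j := fun a b c d i j =>
    congrFun (congrArg (fun f => pd a (pd b f)) (pd_comm c d (hlam i j))) x
  have hfirst : ∀ a b c d i j, D a b c d i j = D d b c a i j := fun a b c d i j => by
    rw [hswap₃, hswap₂, hswap₁, hswap₂, hswap₃]
  have hsecond : ∀ a b c d i j, D a b c d i j = D a d c b i j := fun a b c d i j => by
    rw [hswap₃, hswap₂, hswap₃]
  simp only [curvature, hD]
  linarith [hfirst α β γ μ ν ρ, hfirst α ν γ μ β ρ, hfirst α β ρ μ ν γ, hfirst α ν ρ μ β γ,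
    hsecond α β γ ν μ ρ, hsecond μ β γ ν α ρ, hsecond α β ρ ν μ γ, hsecond μ β ρ ν α γ,
    hswap₃ α β γ ρ μ ν, hswap₃ μ β γ ρ α ν, hswap₃ α ν γ ρ μ β, hswap₃ μ ν γ ρ α β]

/-- **Gauge invariance of the curvature with unconstrained parameters.**  For every
smooth symmetric (not necessarily traceless) `λ`, the curvature tensor of the pure
gauge field `δ_λ h` vanishes identically; consequently `K[h + δ_λ h] = K[h]` for
every spin-3 field `h`. -/
theorem curvature_gauge_invariant (n : ℕ) (hn : 1 ≤ n)
    (lam : (Fin n → ℝ) → Fin n → Fin n → ℝ)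
    (lsmooth : ∀ μ ν : Fin n, ContDiff ℝ (⊤ : ℕ∞) fun x => lam x μ ν)
    (lsym : ∀ x μ ν, lam x μ ν = lam x ν μ) :
    (∀ x α μ β ν γ ρ, curvature (gaugeTransform lam) x α μ β ν γ ρ = 0) ∧
    (∀ h : Spin3 n,
      (∀ μ ν ρ : Fin n, ContDiff ℝ (⊤ : ℕ∞) fun x => h x μ ν ρ) →
      (∀ x μ ν ρ, h x μ ν ρ = h x ν μ ρ) →
      (∀ x μ ν ρ, h x μ ν ρ = h x μ ρ ν) →
      ∀ x α μ β ν γ ρ,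
        curvature (fun y i j k => h y i j k + gaugeTransform lam y i j k) x α μ β ν γ ρ
          = curvature h x α μ β ν γ ρ) := by
  have hzero := curvature_gaugeTransform lsmooth lsym
  refine ⟨hzero, fun h hsmooth _ _ x α μ β ν γ ρ => ?_⟩
  rw [curvature_add hsmooth (contDiff_gaugeTransform lsmooth), hzero, add_zero]
end
end
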